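/- Let K be a field complete with respect to a nonarchimedean absolute value and let L be a field extension of K complete with respect to a nonarchimedean absolute value extending that of K. Fix a nonempty set M, let (U,u) and (V,v) be M-normoid Fréchet spaces over K, and let f : U → V be a bounded K-linear map. If the induced map f_L := f ⊗̂ 1 : U ⊗̂_K L → V ⊗̂_K L has finite-dimensional kernel (as an L-vector space) and is topologically strict, then f is topologically strict. -/

import Mathlib

open scoped TensorProduct

noncomputable section

section NormoidDefs

variable (K : Type*) [NormedField K] {M : Type*}

/-- A nonarchimedean seminorm on a `K`-vector space. -/
def IsNASeminorm {U : Type*} [AddCommGroup U] [Module K U] (p : U → ℝ) : Prop :=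
  (∀ x, 0 ≤ p x) ∧ (∀ (a : K) (x : U), p (a • x) = ‖a‖ * p x) ∧
    ∀ x y, p (x + y) ≤ max (p x) (p y)

/-- A filter is Cauchy with respect to a family of seminorms. -/
def IsCauchyFam {U : Type*} [AddCommGroup U] (u : M → U → ℝ) (F : Filter U) : Prop :=
  F.NeBot ∧ ∀ m, ∀ ε : ℝ, 0 < ε → ∃ S ∈ F, ∀ x ∈ S, ∀ y ∈ S, u m (x - y) < ε

/-- A filter converges to a point with respect to a family of seminorms. -/
def TendstoFam {U : Type*} [AddCommGroup U] (u : M → U → ℝ) (F : Filter U) (x₀ : U) : Prop :=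
  ∀ m, ∀ ε : ℝ, 0 < ε → ∃ S ∈ F, ∀ x ∈ S, u m (x - x₀) < ε

/-- An `M`-Banachoid space over `K`: a `K`-vector space together with a family of
nonarchimedean seminorms for which it is Hausdorff and complete. -/
def IsBanachoid {U : Type*} [AddCommGroup U] [Module K U] (u : M → U → ℝ) : Prop :=
  (∀ m, IsNASeminorm K (u m)) ∧ (∀ x : U, (∀ m, u m x = 0) → x = 0) ∧
    ∀ F : Filter U, IsCauchyFam u F → ∃ x₀, TendstoFam u F x₀

/-- The projective tensor seminorm
`(p ⊗ q)(z) = inf { maxᵢ p(xᵢ)·q(yᵢ) | z = ∑ᵢ xᵢ ⊗ yᵢ }`. -/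
def projTensorSeminorm {A B : Type*} [AddCommGroup A] [Module K A]
    [AddCommGroup B] [Module K B] (p : A → ℝ) (q : B → ℝ) (z : A ⊗[K] B) : ℝ :=
  sInf {r : ℝ | ∃ ℓ : List (A × B),
    z = (ℓ.map fun ab => ab.1 ⊗ₜ[K] ab.2).sum ∧
    r = (ℓ.map fun ab => p ab.1 * q ab.2).foldr max 0}

/-- The family of projective tensor seminorms `(u_m ⊗ v_m)_{m ∈ M}`. -/
def projTensorFamily {A B : Type*} [AddCommGroup A] [Module K A]
    [AddCommGroup B] [Module K B] (u : M → A → ℝ) (v : M → B → ℝ) :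
    M → A ⊗[K] B → ℝ :=
  fun m => projTensorSeminorm K (u m) (v m)

/-- `(W, w, ι)` is (a realization of) the Hausdorff completion of `(T, t)`: `ι` is `K`-linear,
isometric, has dense image, and `(W, w)` is a Hausdorff complete normoid (Banachoid) space. -/
def IsHausdorffCompletion {T W : Type*} [AddCommGroup T] [Module K T]
    [AddCommGroup W] [Module K W] (t : M → T → ℝ) (w : M → W → ℝ) (ι : T → W) : Prop :=
  (∀ x y : T, ι (x + y) = ι x + ι y) ∧ (∀ (c : K) (x : T), ι (c • x) = c • ι x) ∧
  (∀ m x, w m (ι x) = t m x) ∧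
  (∀ (y : W) (s : Finset M) (ε : ℝ), 0 < ε → ∃ x : T, ∀ m ∈ s, w m (y - ι x) < ε) ∧
  IsBanachoid K w

/-- A bounded map between normoid spaces. -/
def IsBoundedMap {A B : Type*} (u : M → A → ℝ) (v : M → B → ℝ) (f : A → B) : Prop :=
  ∀ m, ∃ C : ℝ, ∀ x, v m (f x) ≤ C * u m x

/-- A strict morphism in `Norm_{M,K}`: a contraction inducing an isometry from the coimage
to the image. -/
def IsStrictMap {A B : Type*} (u : M → A → ℝ) (v : M → B → ℝ) (f : A → B) : Prop :=
  (∀ m x, v m (f x) ≤ u m x) ∧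
  ∀ m (y : B), (∃ x, f x = y) → v m y = sInf {r : ℝ | ∃ x, f x = y ∧ r = u m x}

/-- A strict morphism in `Norm^b_{M,K}`: a bounded map such that, up to constants, the
quotient seminorms of the coimage are bounded by the seminorms of the image. -/
def IsStrictMapB {A B : Type*} (u : M → A → ℝ) (v : M → B → ℝ) (f : A → B) : Prop :=
  IsBoundedMap u v f ∧
  ∀ m, ∃ D : ℝ, ∀ y : B, (∃ x, f x = y) →
    sInf {r : ℝ | ∃ x, f x = y ∧ r = u m x} ≤ D * v m y

/-- The quotient family of seminorms on `V ⧸ p`. -/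
def quotFamily {V : Type*} [AddCommGroup V] [Module K V] (v : M → V → ℝ)
    (p : Submodule K V) : M → (V ⧸ p) → ℝ :=
  fun m q => sInf {r : ℝ | ∃ x : V, Submodule.Quotient.mk x = q ∧ r = v m x}

/-- The restricted family of seminorms on a submodule `p ≤ V`. -/
def restrictFamily {V : Type*} [AddCommGroup V] [Module K V] (v : M → V → ℝ)
    (p : Submodule K V) : M → ↥p → ℝ :=
  fun m x => v m (x : V)

end NormoidDefs

section TopDefs

variable (K : Type*) [NormedField K] {M : Type*}

/-- A family of seminorms `u` is finer than a family `q` (possibly indexed differently). -/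
def FamFiner {U : Type*} {M N : Type*} (u : M → U → ℝ) (q : N → U → ℝ) : Prop :=
  ∀ m, ∃ (s : Finset N) (hs : s.Nonempty) (C : ℝ), ∀ x, u m x ≤ C * s.sup' hs fun n => q n x

/-- An `M`-normoid Fréchet space: a Banachoid space whose family of seminorms is equivalent
to a countable family of nonarchimedean seminorms. -/
def IsFrechetFam {U : Type*} [AddCommGroup U] [Module K U] (u : M → U → ℝ) : Prop :=
  IsBanachoid K u ∧
    ∃ q : ℕ → U → ℝ, (∀ n, IsNASeminorm K (q n)) ∧ FamFiner u q ∧ FamFiner q u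

/-- The topology on `U` induced by a family of seminorms: it is generated by the open balls
`{y | u m (y - x) < ε}`. -/
def famTopology {U : Type*} [AddCommGroup U] (u : M → U → ℝ) : TopologicalSpace U :=
  TopologicalSpace.generateFrom
    {B : Set U | ∃ (m : M) (x : U) (ε : ℝ), 0 < ε ∧ B = {y | u m (y - x) < ε}}

/-- A linear map `f : A → B` between topological vector spaces is topologically strict if the
induced bijection `A ⧸ Ker f → Im f` (with the quotient topology on the source and the
subspace topology on the target) is a homeomorphism. -/
def TopologicallyStrict {R A B : Type*} [Ring R] [AddCommGroup A] [Module R A]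
    [AddCommGroup B] [Module R B] (tA : TopologicalSpace A) (tB : TopologicalSpace B)
    (f : A →ₗ[R] B) : Prop :=
  letI := tA
  letI := tB
  Continuous ⇑(LinearMap.quotKerEquivRange f) ∧
    Continuous ⇑(LinearMap.quotKerEquivRange f).symm

end TopDefs

section AlmostOrthogonal

variable {K E : Type*} [NormedField K] [NormedAddCommGroup E] [NormedSpace K E]

theorem ultra_norm_sub_le_max {E : Type*} [NormedAddCommGroup E] [IsUltrametricDist E] (x y : E) :
    ‖x - y‖ ≤ max ‖x‖ ‖y‖ := by
  simpa [sub_eq_add_neg] using IsUltrametricDist.norm_add_le_max x (-y)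

/-- In a subspace that is not everything, a vector outside a closed subspace can be corrected by
an element of the subspace so as to become almost orthogonal to it. -/
theorem exists_almost_orthogonal [IsUltrametricDist E] {F : Submodule K E}
    (hF : IsClosed (F : Set E)) {a : E} (ha : a ∉ F) {C : ℝ} (hC : 1 < C) :
    ∃ (e : E) (ψ : E →ₗ[K] K), e ≠ 0 ∧ e ∈ Submodule.span K {a} ⊔ F ∧ (∀ x ∈ F, ψ x = 0) ∧
      ∀ x ∈ Submodule.span K {a} ⊔ F, x - ψ x • e ∈ F ∧ ‖ψ x‖ * ‖e‖ ≤ C * ‖x‖ ∧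
        ‖x - ψ x • e‖ ≤ C * ‖x‖ := by
  obtain ⟨g, hga, hg⟩ := Submodule.exists_le_ker_of_notMem ha
  have hgF : ∀ x ∈ F, g x = 0 := fun x hx => hg hx
  have hd : 0 < Metric.infDist a F := (hF.notMem_iff_infDist_pos ⟨0, F.zero_mem⟩).1 ha
  have hlt : Metric.infDist a F < C * Metric.infDist a F := by nlinarith
  obtain ⟨b, hb, hab⟩ := (Metric.infDist_lt_iff ⟨0, F.zero_mem⟩).1 hlt
  rw [dist_eq_norm] at hab
  have key : ∀ c : K, ∀ y ∈ F, ‖c‖ * ‖a - b‖ ≤ C * ‖c • a + y‖ := by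
    intro c y hy
    rcases eq_or_ne c 0 with rfl | hc
    · simpa using by positivity
    have h1 : Metric.infDist a F ≤ ‖a + c⁻¹ • y‖ := by
      have := Metric.infDist_le_dist_of_mem (x := a) (F.neg_mem (F.smul_mem c⁻¹ hy))
      rwa [dist_eq_norm, sub_neg_eq_add] at this
    have h2 : c • a + y = c • (a + c⁻¹ • y) := by rw [smul_add, smul_inv_smul₀ hc]
    rw [h2, norm_smul]
    have h3 : ‖a - b‖ ≤ C * ‖a + c⁻¹ • y‖ := hab.le.trans (by gcongr)
    calc ‖c‖ * ‖a - b‖ ≤ ‖c‖ * (C * ‖a + c⁻¹ • y‖) := by gcongr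
      _ = _ := by ring
  refine ⟨a - b, (g a)⁻¹ • g, sub_ne_zero.2 (fun h => ha (h ▸ hb)),
    Submodule.sub_mem _ (Submodule.mem_sup_left (Submodule.mem_span_singleton_self a))
      (Submodule.mem_sup_right hb), fun x hx => by
    simp [hgF x hx], fun x hx => ?_⟩
  obtain ⟨y, hy, z, hz, rfl⟩ := Submodule.mem_sup.1 hx
  obtain ⟨c, rfl⟩ := Submodule.mem_span_singleton.1 hy
  have hψ : ((g a)⁻¹ • g) (c • a + z) = c := by
    simp [hgF z hz, hga, mul_comm]
  rw [hψ]
  refine ⟨?_, key c z hz, ?_⟩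
  · have : c • a + z - c • (a - b) = c • b + z := by module
    rw [this]
    exact F.add_mem (F.smul_mem c hb) hz
  · refine (ultra_norm_sub_le_max _ _).trans (max_le ?_ ?_)
    · nlinarith [norm_nonneg (c • a + z)]
    · rw [norm_smul]
      exact key c z hz

/-- A subspace has a finite generating system whose coordinate functionals are bounded as for a
`C`-orthogonal basis. -/
def HasOrthogonalFrame (F : Submodule K E) (C : ℝ) : Prop :=
  ∃ (n : Type) (_ : Fintype n) (e : n → E) (φ : n → E →ₗ[K] K), (∀ i, e i ≠ 0) ∧
    (∀ i, e i ∈ F) ∧ (∀ x ∈ F, ∑ i, φ i x • e i = x) ∧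
      ∀ i, ∀ x ∈ F, ‖φ i x‖ * ‖e i‖ ≤ C * ‖x‖

theorem HasOrthogonalFrame.isClosed [CompleteSpace K] {F : Submodule K E} {C : ℝ}
    (h : HasOrthogonalFrame F C) : IsClosed (F : Set E) := by
  obtain ⟨n, _, e, φ, he, heF, hsum, hb⟩ := h
  refine isClosed_of_closure_subset fun x hx => ?_
  obtain ⟨y, hy, hlim⟩ := mem_closure_iff_seq_limit.1 hx
  have hc : ∀ i, ∃ c, Filter.Tendsto (fun k => φ i (y k)) Filter.atTop (nhds c) := by
    intro i
    refine cauchySeq_tendsto_of_complete ?_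
    have hei : 0 < ‖e i‖ := norm_pos_iff.2 (he i)
    have hyc := hlim.cauchySeq
    rw [Metric.cauchySeq_iff] at hyc ⊢
    intro ε hε
    obtain ⟨N, hN⟩ := hyc (ε * ‖e i‖ / (|C| + 1)) (by positivity)
    refine ⟨N, fun k hk l hl => ?_⟩
    have h1 := hN k hk l hl
    rw [dist_eq_norm, lt_div_iff₀ (by positivity)] at h1
    rw [dist_eq_norm, ← map_sub]
    have h2 := hb i _ (F.sub_mem (hy k) (hy l))
    have h3 : C * ‖y k - y l‖ ≤ ‖y k - y l‖ * (|C| + 1) := by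
      nlinarith [norm_nonneg (y k - y l), le_abs_self C]
    exact lt_of_mul_lt_mul_right (h2.trans_lt (h3.trans_lt h1)) hei.le
  choose c hc using hc
  have hlim' : Filter.Tendsto y Filter.atTop (nhds (∑ i, c i • e i)) := by
    have : Filter.Tendsto (fun k => ∑ i, φ i (y k) • e i) Filter.atTop
        (nhds (∑ i, c i • e i)) := tendsto_finsetSum _ fun i _ => (hc i).smul_const (e i)
    exact this.congr fun k => hsum _ (hy k)
  rw [tendsto_nhds_unique hlim hlim']
  exact F.sum_mem fun i _ => F.smul_mem _ (heF i)

theorem hasOrthogonalFrame_span [CompleteSpace K] [IsUltrametricDist E] [DecidableEq E]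
    (s : Finset E) : ∀ C : ℝ, 1 < C → HasOrthogonalFrame (Submodule.span K (s : Set E)) C := by
  induction s using Finset.induction_on with
  | empty =>
    intro C _
    refine ⟨Empty, inferInstance, Empty.elim, fun i => i.elim, fun i => i.elim, fun i => i.elim,
      fun x hx => ?_, fun i => i.elim⟩
    simp_all
  | insert a s _ ih =>
    intro C hC
    have hC1 : 1 < √C := by rwa [Real.lt_sqrt zero_le_one, one_pow]
    have hsq : √C * √C = C := Real.mul_self_sqrt (by linarith)
    have hF := ih _ hC1
    rw [Finset.coe_insert, Submodule.span_insert]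
    by_cases ha : a ∈ Submodule.span K (s : Set E)
    · rw [sup_eq_right.2 ((Submodule.span_singleton_le_iff_mem _ _).2 ha)]
      exact ih C hC
    obtain ⟨b, ψ, hb0, hbm, hψF, hψ⟩ := exists_almost_orthogonal hF.isClosed ha hC1
    obtain ⟨n, _, e, φ, he, heF, hsum, hb⟩ := hF
    refine ⟨Option n, inferInstance, fun i => i.elim b e,
      fun i => i.elim ψ fun i => φ i ∘ₗ (LinearMap.id - ψ.smulRight b), ?_, ?_, ?_, ?_⟩
    · rintro (_ | i)
      exacts [hb0, he i]
    · rintro (_ | i)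
      exacts [hbm, Submodule.mem_sup_right (heF i)]
    · intro x hx
      have := hsum _ (hψ x hx).1
      simp only [Fintype.sum_option, Option.elim, LinearMap.comp_apply, LinearMap.sub_apply,
        LinearMap.id_apply, LinearMap.smulRight_apply]
      rw [this]
      abel
    · rintro (_ | i) x hx
      · refine (hψ x hx).2.1.trans ?_
        gcongr
        nlinarith
      · have h1 := hb i _ (hψ x hx).1
        have h2 := (hψ x hx).2.2
        simp only [Option.elim, LinearMap.comp_apply, LinearMap.sub_apply,
          LinearMap.id_apply, LinearMap.smulRight_apply]
        calc _ ≤ √C * ‖x - ψ x • b‖ := h1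
          _ ≤ √C * (√C * ‖x‖) := by gcongr
          _ = C * ‖x‖ := by rw [← mul_assoc, hsq]

theorem Submodule.FG.hasOrthogonalFrame [CompleteSpace K] [IsUltrametricDist E]
    {F : Submodule K E} (hF : F.FG) {C : ℝ} (hC : 1 < C) : HasOrthogonalFrame F C := by
  classical
  obtain ⟨s, rfl⟩ := hF
  exact hasOrthogonalFrame_span s C hC

theorem Submodule.FG.exists_almost_contractive_projection [CompleteSpace K] [IsUltrametricDist E]
    {F G : Submodule K E} (hF : F.FG) (hG : G.FG) {C : ℝ} (hC : 1 < C) :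
    ∃ π : E →ₗ[K] E, (∀ x ∈ F, π x = x) ∧ ∀ x ∈ F ⊔ G, π x ∈ F ∧ ‖π x‖ ≤ C * ‖x‖ := by
  classical
  obtain ⟨s, rfl⟩ := hG
  induction s using Finset.induction_on generalizing C with
  | empty =>
    refine ⟨LinearMap.id, fun x _ => rfl, fun x hx => ⟨by simpa using hx, ?_⟩⟩
    simp only [LinearMap.id_apply]
    nlinarith [norm_nonneg x]
  | insert a s _ ih =>
    have hC1 : 1 < √C := by rwa [Real.lt_sqrt zero_le_one, one_pow]
    have hsq : √C * √C = C := Real.mul_self_sqrt (by linarith)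
    rw [Finset.coe_insert, Submodule.span_insert, sup_left_comm]
    by_cases ha : a ∈ F ⊔ Submodule.span K (s : Set E)
    · rw [sup_eq_right.2 ((Submodule.span_singleton_le_iff_mem _ _).2 ha)]
      exact ih hC
    obtain ⟨b, ψ, -, -, hψF, hψ⟩ := exists_almost_orthogonal
      ((hF.sup (Submodule.fg_span s.finite_toSet)).hasOrthogonalFrame hC1).isClosed ha hC1
    obtain ⟨π, hπF, hπ⟩ := ih hC1
    refine ⟨π ∘ₗ (LinearMap.id - ψ.smulRight b), fun x hx => ?_, fun x hx => ?_⟩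
    · simp [hψF x (Submodule.mem_sup_left hx), hπF x hx]
    · obtain ⟨h1, -, h2⟩ := hψ x hx
      obtain ⟨h3, h4⟩ := hπ _ h1
      simp only [LinearMap.comp_apply, LinearMap.sub_apply,
        LinearMap.id_apply, LinearMap.smulRight_apply]
      refine ⟨h3, h4.trans ?_⟩
      calc √C * ‖x - ψ x • b‖ ≤ √C * (√C * ‖x‖) := by gcongr
        _ = C * ‖x‖ := by rw [← mul_assoc, hsq]

/-- A bounded functional extends along an increasing sequence of finite-dimensional subspaces with
an arbitrarily small loss, here bounded by a factor `2`. -/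
theorem exists_functional_extension_seq [CompleteSpace K] [IsUltrametricDist E]
    {F : ℕ → Submodule K E} (hmono : Monotone F) (hF : ∀ k, (F k).FG) (φ : E →ₗ[K] K) {D : ℝ}
    (hD : 0 ≤ D) (hφ : ∀ x ∈ F 0, ‖φ x‖ ≤ D * ‖x‖) :
    ∃ Φ : ℕ → E →ₗ[K] K, Φ 0 = φ ∧ (∀ k l, k ≤ l → ∀ x ∈ F k, Φ l x = Φ k x) ∧
      ∀ k, ∀ x ∈ F k, ‖Φ k x‖ ≤ 2 * D * ‖x‖ := by
  have hc : ∀ k : ℕ, 0 < 2 - (1 / 2 : ℝ) ^ k := fun k => by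
    have := pow_le_one₀ (n := k) (by norm_num : (0 : ℝ) ≤ 1 / 2) (by norm_num)
    linarith
  have hlt : ∀ k : ℕ, 1 < (2 - (1 / 2 : ℝ) ^ (k + 1)) / (2 - (1 / 2 : ℝ) ^ k) := fun k => by
    rw [one_lt_div (hc k), pow_succ]
    have : (0 : ℝ) < (1 / 2) ^ k := by positivity
    linarith
  choose π hπF hπ using fun k =>
    (hF k).exists_almost_contractive_projection (hF (k + 1)) (hlt k)
  let Φ : ℕ → E →ₗ[K] K := fun k => Nat.rec φ (fun k ψ => ψ ∘ₗ π k) k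
  have hsucc : ∀ k, Φ (k + 1) = Φ k ∘ₗ π k := fun k => rfl
  refine ⟨Φ, rfl, fun k l hkl => ?_, ?_⟩
  · induction l, hkl using Nat.le_induction with
    | base => exact fun x _ => rfl
    | succ l hkl ih =>
      intro x hx
      rw [hsucc, LinearMap.comp_apply, hπF l x (hmono hkl hx), ih x hx]
  · have main : ∀ k, ∀ x ∈ F k, ‖Φ k x‖ ≤ (2 - (1 / 2 : ℝ) ^ k) * D * ‖x‖ := by
      intro k
      induction k with
      | zero =>
        intro x hx
        refine (hφ x hx).trans_eq ?_
        norm_num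
      | succ k ih =>
        intro x hx
        obtain ⟨h1, h2⟩ := hπ k x (Submodule.mem_sup_right hx)
        rw [hsucc, LinearMap.comp_apply]
        have := hc k
        calc _ ≤ (2 - (1 / 2 : ℝ) ^ k) * D * ‖π k x‖ := ih _ h1
          _ ≤ (2 - (1 / 2 : ℝ) ^ k) * D *
              ((2 - (1 / 2 : ℝ) ^ (k + 1)) / (2 - (1 / 2 : ℝ) ^ k) * ‖x‖) := by gcongr
          _ = _ := by field_simp
    intro k x hx
    refine (main k x hx).trans ?_
    gcongr
    have : (0 : ℝ) < (1 / 2) ^ k := by positivity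
    linarith

end AlmostOrthogonal

section NASeminorm

variable {K U : Type*} [NormedField K] [AddCommGroup U] [Module K U] {p : U → ℝ}

theorem IsNASeminorm.map_zero (hp : IsNASeminorm K p) : p 0 = 0 := by
  simpa using hp.2.1 0 0

theorem IsNASeminorm.map_neg (hp : IsNASeminorm K p) (x : U) : p (-x) = p x := by
  simpa using hp.2.1 (-1) x

theorem IsNASeminorm.map_sub_rev (hp : IsNASeminorm K p) (x y : U) : p (x - y) = p (y - x) := by
  rw [← hp.map_neg, neg_sub]

theorem IsNASeminorm.sub_le_max (hp : IsNASeminorm K p) (x y z : U) :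
    p (x - z) ≤ max (p (x - y)) (p (y - z)) := by
  simpa using hp.2.2 (x - y) (y - z)

theorem IsNASeminorm.list_sum_le (hp : IsNASeminorm K p) {α : Type*} (ℓ : List α) (g : α → U)
    (h : α → ℝ) {c : ℝ} (hc : 0 ≤ c) (H : ∀ a ∈ ℓ, p (g a) ≤ c * h a) :
    p (ℓ.map g).sum ≤ c * (ℓ.map h).foldr max 0 := by
  induction ℓ with
  | nil => simp [hp.map_zero]
  | cons a ℓ ih =>
    simp only [List.map_cons, List.sum_cons, List.foldr_cons]
    rw [mul_max_of_nonneg _ _ hc]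
    refine (hp.2.2 _ _).trans (max_le_max (H a (by simp)) (ih fun b hb => H b (by simp [hb])))

end NASeminorm

section Contraction

variable {K E : Type*} [NormedField K] [NormedAddCommGroup E] [NormedSpace K E]
  {U : Type*} [AddCommGroup U] [Module K U] {V : Type*} [AddCommGroup V] [Module K V]

variable (U) in
/-- Contraction of the first factor of a tensor product against a linear functional. -/
def tensorContract (φ : E →ₗ[K] K) : E ⊗[K] U →ₗ[K] U :=
  (TensorProduct.lid K U).toLinearMap ∘ₗ φ.rTensor U

@[simp]
theorem tensorContract_tmul (φ : E →ₗ[K] K) (a : E) (x : U) :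
    tensorContract U φ (a ⊗ₜ[K] x) = φ a • x := by
  simp [tensorContract]

variable (U) in
/-- The tensors that can be written with first components in a given subspace. -/
def tensorSubspace (F : Submodule K E) : Submodule K (E ⊗[K] U) :=
  Submodule.map₂ (TensorProduct.mk K E U) F ⊤

theorem tensorSubspace_mono {F G : Submodule K E} (h : F ≤ G) :
    tensorSubspace U F ≤ tensorSubspace U G :=
  Submodule.map₂_le_map₂_left h

theorem linearMap_eq_of_mem_tensorSubspace {W : Type*} [AddCommGroup W] [Module K W]
    {F : Submodule K E} {A B : E ⊗[K] U →ₗ[K] W}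
    (h : ∀ a ∈ F, ∀ x, A (a ⊗ₜ x) = B (a ⊗ₜ x)) {t : E ⊗[K] U} (ht : t ∈ tensorSubspace U F) :
    A t = B t := by
  have : tensorSubspace U F ≤ LinearMap.eqLocus A B :=
    Submodule.map₂_le.2 fun a ha x _ => h a ha x
  exact this ht

theorem tensorContract_congr {F : Submodule K E} {φ ψ : E →ₗ[K] K} (h : ∀ a ∈ F, φ a = ψ a)
    {t : E ⊗[K] U} (ht : t ∈ tensorSubspace U F) : tensorContract U φ t = tensorContract U ψ t :=
  linearMap_eq_of_mem_tensorSubspace (fun a ha x => by simp [h a ha]) ht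

theorem sum_tmul_tensorContract {F : Submodule K E} {n : Type*} [Fintype n] {e : n → E}
    {φ : n → E →ₗ[K] K} (h : ∀ a ∈ F, ∑ i, φ i a • e i = a) {t : E ⊗[K] U}
    (ht : t ∈ tensorSubspace U F) : ∑ i, e i ⊗ₜ[K] tensorContract U (φ i) t = t := by
  have := linearMap_eq_of_mem_tensorSubspace
    (A := ∑ i, (TensorProduct.mk K E U (e i)) ∘ₗ tensorContract U (φ i)) (B := LinearMap.id)
    (fun a ha x => ?_) ht
  · simpa using this
  · simp only [LinearMap.sum_apply, LinearMap.comp_apply, tensorContract_tmul,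
      TensorProduct.mk_apply, LinearMap.id_apply, TensorProduct.tmul_smul]
    simp only [TensorProduct.smul_tmul', ← TensorProduct.sum_tmul, h a ha]

theorem exists_fg_mem_tensorSubspace (t : E ⊗[K] U) :
    ∃ F : Submodule K E, F.FG ∧ t ∈ tensorSubspace U F := by
  induction t using TensorProduct.induction_on with
  | zero => exact ⟨⊥, Submodule.fg_bot, Submodule.zero_mem _⟩
  | tmul a x => exact ⟨Submodule.span K {a}, Submodule.fg_span_singleton a,
      Submodule.apply_mem_map₂ _ (Submodule.mem_span_singleton_self a) trivial⟩
  | add t t' h h' =>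
    obtain ⟨F, hF, ht⟩ := h
    obtain ⟨G, hG, ht'⟩ := h'
    exact ⟨F ⊔ G, hF.sup hG, Submodule.add_mem _ (tensorSubspace_mono le_sup_left ht)
      (tensorSubspace_mono le_sup_right ht')⟩

theorem tensorContract_map (φ : E →ₗ[K] K) (f : U →ₗ[K] V) (t : E ⊗[K] U) :
    tensorContract V φ (TensorProduct.map LinearMap.id f t) = f (tensorContract U φ t) := by
  induction t using TensorProduct.induction_on with
  | zero => simp
  | tmul a x => simp
  | add t t' h h' => simp [h, h']

theorem map_mem_tensorSubspace {F : Submodule K E} (f : U →ₗ[K] V) {t : E ⊗[K] U}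
    (ht : t ∈ tensorSubspace U F) :
    TensorProduct.map LinearMap.id f t ∈ tensorSubspace V F := by
  have : tensorSubspace U F ≤ (tensorSubspace V F).comap (TensorProduct.map LinearMap.id f) :=
    Submodule.map₂_le.2 fun a ha x _ => by
      rw [Submodule.mem_comap, TensorProduct.mk_apply, TensorProduct.map_tmul]
      exact Submodule.apply_mem_map₂ (TensorProduct.mk K E V) ha (q := ⊤) trivial
  exact this ht

end Contraction

section TensorSeminorm

variable {K E : Type*} [NormedField K] [NormedAddCommGroup E] [NormedSpace K E]
  {U : Type*} [AddCommGroup U] [Module K U]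

theorem exists_list_tmul_sum (t : E ⊗[K] U) :
    ∃ ℓ : List (E × U), t = (ℓ.map fun ab => ab.1 ⊗ₜ[K] ab.2).sum := by
  induction t using TensorProduct.induction_on with
  | zero => exact ⟨[], by simp⟩
  | tmul a x => exact ⟨[(a, x)], by simp⟩
  | add t t' h h' =>
    obtain ⟨ℓ, rfl⟩ := h
    obtain ⟨ℓ', rfl⟩ := h'
    exact ⟨ℓ ++ ℓ', by simp⟩

theorem le_foldr_max (ℓ : List ℝ) : 0 ≤ ℓ.foldr max 0 := by
  induction ℓ with
  | nil => simp
  | cons a ℓ ih => exact le_max_of_le_right ih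

theorem foldr_max_le {ℓ : List ℝ} {r : ℝ} (hr : 0 ≤ r) (h : ∀ a ∈ ℓ, a ≤ r) :
    ℓ.foldr max 0 ≤ r := by
  induction ℓ with
  | nil => simpa
  | cons a ℓ ih => exact max_le (h a (by simp)) (ih fun b hb => h b (by simp [hb]))

theorem projTensorSeminorm_sum_le {p : U → ℝ} {n : Type*} [Fintype n]
    (e : n → E) (x : n → U) {r : ℝ} (hr : 0 ≤ r) (h : ∀ i, ‖e i‖ * p (x i) ≤ r) :
    projTensorSeminorm K (fun a : E => ‖a‖) p (∑ i, e i ⊗ₜ[K] x i) ≤ r := by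
  unfold projTensorSeminorm
  refine le_trans (csInf_le ⟨0, ?_⟩ ⟨Finset.univ.toList.map fun i => (e i, x i), ?_, rfl⟩)
    (foldr_max_le hr ?_)
  · rintro _ ⟨ℓ, -, rfl⟩
    exact le_foldr_max _
  · simp [List.map_map, Function.comp_def]
  · simpa using h

theorem projTensorSeminorm_tmul_le {p : U → ℝ} (hp : ∀ x, 0 ≤ p x) (a : E) (x : U) :
    projTensorSeminorm K (fun a : E => ‖a‖) p (a ⊗ₜ[K] x) ≤ ‖a‖ * p x := by
  simpa using projTensorSeminorm_sum_le (K := K) (p := p) (fun _ : Unit => a) (fun _ => x)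
    (mul_nonneg (norm_nonneg a) (hp x)) fun _ => le_rfl

/-- A functional that is bounded by `D` on `F` contracts tensors over `F` with bound `2 * D` for
the projective tensor seminorm of the whole space. -/
theorem seminorm_tensorContract_le [CompleteSpace K] [IsUltrametricDist E] {p : U → ℝ}
    (hp : IsNASeminorm K p) {F : Submodule K E} (hF : F.FG) {φ : E →ₗ[K] K} {D : ℝ} (hD : 0 < D)
    (hφ : ∀ a ∈ F, ‖φ a‖ ≤ D * ‖a‖) {t : E ⊗[K] U} (ht : t ∈ tensorSubspace U F) :
    p (tensorContract U φ t) ≤ 2 * D * projTensorSeminorm K (fun a : E => ‖a‖) p t := by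
  rw [← div_le_iff₀' (by positivity)]
  obtain ⟨ℓ₀, hℓ₀⟩ := exists_list_tmul_sum t
  refine le_csInf ⟨_, ℓ₀, hℓ₀, rfl⟩ ?_
  rintro _ ⟨ℓ, hℓ, rfl⟩
  rw [div_le_iff₀' (by positivity)]
  obtain ⟨π, hπF, hπ⟩ := hF.exists_almost_contractive_projection
    (Submodule.fg_span (R := K) (List.finite_toSet (ℓ.map Prod.fst))) one_lt_two
  have h1 : tensorContract U φ t = tensorContract U (φ ∘ₗ π) t :=
    tensorContract_congr (fun a ha => by simp [hπF a ha]) ht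
  rw [h1, hℓ, map_list_sum, List.map_map]
  refine hp.list_sum_le _ _ _ (by positivity) fun ab hab => ?_
  obtain ⟨h2, h3⟩ := hπ ab.1 (Submodule.mem_sup_right (Submodule.subset_span
    (List.mem_map_of_mem hab)))
  simp only [Function.comp_apply, tensorContract_tmul, LinearMap.comp_apply, hp.2.1]
  have := hp.1 ab.2
  calc _ ≤ (D * (2 * ‖ab.1‖)) * p ab.2 := by
        gcongr
        exact (hφ _ h2).trans (by gcongr)
    _ = _ := by ring

theorem projTensorSeminorm_le_of_forall_le [CompleteSpace K] [IsUltrametricDist E] {M : Type*}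
    {u : M → U → ℝ} (hu : ∀ m, IsNASeminorm K (u m)) {p : U → ℝ} {s : Finset M} {C : ℝ}
    (hC : 0 ≤ C) (h : ∀ x r, 0 ≤ r → (∀ m ∈ s, u m x ≤ r) → p x ≤ C * r) {t : E ⊗[K] U} {r : ℝ}
    (hr : 0 ≤ r) (ht : ∀ m ∈ s, projTensorSeminorm K (fun a : E => ‖a‖) (u m) t ≤ r) :
    projTensorSeminorm K (fun a : E => ‖a‖) p t ≤ 4 * C * r := by
  obtain ⟨F, hF, htF⟩ := exists_fg_mem_tensorSubspace t
  obtain ⟨n, _, e, φ, he, heF, hsum, hb⟩ := hF.hasOrthogonalFrame one_lt_two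
  rw [← sum_tmul_tensorContract hsum htF]
  refine projTensorSeminorm_sum_le _ _ (by positivity) fun i => ?_
  have hei : 0 < ‖e i‖ := norm_pos_iff.2 (he i)
  have h1 : p (tensorContract U (φ i) t) ≤ C * (2 * (2 / ‖e i‖) * r) := by
    refine h _ _ (by positivity) fun m hm => ?_
    refine (seminorm_tensorContract_le (hu m) hF (by positivity : 0 < 2 / ‖e i‖)
      (fun a ha => ?_) htF).trans ?_
    · rw [div_mul_eq_mul_div, le_div_iff₀ hei]
      exact hb i a ha
    · have := ht m hm
      gcongr
  calc _ ≤ ‖e i‖ * (C * (2 * (2 / ‖e i‖) * r)) := by gcongr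
    _ = 4 * C * r := by field_simp; ring

end TensorSeminorm

section Exhaustion

theorem FamFiner.le_of_forall_le {M N U : Type*} {u : M → U → ℝ} {q : N → U → ℝ}
    (h : FamFiner u q) (hq : ∀ n x, 0 ≤ q n x) (m : M) :
    ∃ (s : Finset N) (C : ℝ), 0 ≤ C ∧
      ∀ x r, 0 ≤ r → (∀ n ∈ s, q n x ≤ r) → u m x ≤ C * r := by
  obtain ⟨s, hs, C, hC⟩ := h m
  refine ⟨s, max C 0, le_max_right _ _, fun x r hr hx => (hC x).trans ?_⟩
  obtain ⟨n, hn⟩ := hs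
  have h0 : 0 ≤ s.sup' ⟨n, hn⟩ fun n => q n x :=
    (hq n x).trans (Finset.le_sup' (fun n => q n x) hn)
  exact mul_le_mul (le_max_left _ _) (Finset.sup'_le _ _ hx) h0 (le_max_right _ _)

theorem IsFrechetFam.exists_exhaustion {K M U : Type*} [NormedField K] [AddCommGroup U]
    [Module K U] {u : M → U → ℝ} (hu : IsFrechetFam K u) :
    ∃ S : ℕ → Finset M, Monotone S ∧ ∀ m, ∃ (n : ℕ) (C : ℝ), 0 ≤ C ∧
      ∀ x r, 0 ≤ r → (∀ i ∈ S n, u i x ≤ r) → u m x ≤ C * r := by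
  classical
  obtain ⟨hb, q, hq, huq, hqu⟩ := hu
  choose s c hc hs using hqu.le_of_forall_le fun m => (hb.1 m).1
  refine ⟨fun n => (Finset.range (n + 1)).biUnion s, fun a b hab =>
    Finset.biUnion_subset_biUnion_of_subset_left _ (Finset.range_subset_range.2 (by omega)),
    fun m => ?_⟩
  obtain ⟨σ, C, hC, h⟩ := huq.le_of_forall_le (fun n => (hq n).1) m
  refine ⟨σ.sup id, C * ∑ n ∈ σ, c n, mul_nonneg hC (Finset.sum_nonneg fun n _ => hc n),
    fun x r hr hx => ?_⟩
  rw [mul_assoc]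
  refine h x _ (mul_nonneg (Finset.sum_nonneg fun n _ => hc n) hr) fun n hn => ?_
  refine (hs n x r hr fun i hi => hx i ?_).trans ?_
  · have : n ≤ σ.sup id := Finset.le_sup (f := id) hn
    exact Finset.mem_biUnion.2 ⟨n, Finset.mem_range.2 (by omega), hi⟩
  · gcongr
    exact Finset.single_le_sum (fun n _ => hc n) hn

end Exhaustion

section Completion

variable {K E : Type*} [NormedField K] [CompleteSpace K] [NormedAddCommGroup E] [NormedSpace K E]
  [IsUltrametricDist E] {M : Type*} {U : Type*} [AddCommGroup U] [Module K U]
  {W : Type*} [AddCommGroup W] [Module K W]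

theorem IsHausdorffCompletion.exists_seq {u : M → U → ℝ} (hu : IsFrechetFam K u)
    {w : M → W → ℝ} {ι : E ⊗[K] U →+ W}
    (h : IsHausdorffCompletion K (projTensorFamily K (fun _ : M => fun a : E => ‖a‖) u) w ι)
    (z : W) : ∃ t : ℕ → E ⊗[K] U, ∀ m (ε : ℝ), 0 < ε → ∃ N, ∀ k, N ≤ k → w m (z - ι (t k)) < ε := by
  classical
  obtain ⟨S, hS, hm⟩ := hu.exists_exhaustion
  obtain ⟨-, -, hiso, hdense, hban⟩ := h
  have hpos : ∀ k : ℕ, (0 : ℝ) < 1 / ((k : ℝ) + 1) := fun k => by positivity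
  choose t ht using fun k : ℕ => hdense z (S k) (1 / ((k : ℝ) + 1)) (hpos k)
  refine ⟨t, fun m ε hε => ?_⟩
  obtain ⟨n, C, hC, hn⟩ := hm m
  have hδ : 0 < ε / (4 * C + 2) := by positivity
  obtain ⟨N, hN⟩ := exists_nat_one_div_lt hδ
  refine ⟨max N n, fun k hk => ?_⟩
  obtain ⟨t', ht'⟩ := hdense z (insert m (S n)) _ hδ
  have h1 : w m (ι t' - ι (t k)) ≤ 4 * C * (ε / (4 * C + 2)) := by
    rw [← map_sub, hiso]
    refine projTensorSeminorm_le_of_forall_le hu.1.1 hC hn hδ.le fun i hi => ?_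
    have h2 : w i (ι t' - ι (t k)) ≤ ε / (4 * C + 2) := by
      refine ((hban.1 i).sub_le_max _ z _).trans (max_le ?_ ?_)
      · rw [(hban.1 i).map_sub_rev]
        exact (ht' i (Finset.mem_insert_of_mem hi)).le
      · refine (ht k i (hS ((le_max_right _ _).trans hk) hi)).le.trans (le_trans ?_ hN.le)
        have : (N : ℝ) ≤ k := by exact_mod_cast (le_max_left _ _).trans hk
        gcongr
    rw [← map_sub, hiso] at h2
    exact h2
  have h3 : 4 * C * (ε / (4 * C + 2)) < ε := by
    rw [mul_div_assoc', div_lt_iff₀ (by positivity)]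
    nlinarith
  have h4 : ε / (4 * C + 2) < ε := div_lt_self hε (by linarith)
  exact ((hban.1 m).sub_le_max _ (ι t') _).trans_lt
    (max_lt ((ht' m (Finset.mem_insert_self _ _)).trans h4) (h1.trans_lt h3))

variable {V : Type*} [AddCommGroup V] [Module K V] {W' : Type*} [AddCommGroup W'] [Module K W']

/-- Elements of the kernel of the completed map `1 ⊗̂ f` are approximated by elements of
`E ⊗ ker f`. -/
theorem exists_tensor_ker_approx {u : M → U → ℝ} (hu : IsFrechetFam K u) {v : M → V → ℝ}
    (hv : IsBanachoid K v) {f : U →ₗ[K] V} (hf : IsBoundedMap u v f) {w : M → W → ℝ}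
    {ι : E ⊗[K] U →+ W}
    (h : IsHausdorffCompletion K (projTensorFamily K (fun _ : M => fun a : E => ‖a‖) u) w ι)
    {w' : M → W' → ℝ} {ι' : E ⊗[K] V →+ W'}
    (h' : IsHausdorffCompletion K (projTensorFamily K (fun _ : M => fun a : E => ‖a‖) v) w' ι')
    {g : W →+ W'} (hg : IsBoundedMap w w' g)
    (hcomm : ∀ t, g (ι t) = ι' (TensorProduct.map LinearMap.id f t)) {z : W} (hz : g z = 0)
    (s : Finset M) {ε : ℝ} (hε : 0 < ε) :
    ∃ t ∈ Submodule.map₂ (TensorProduct.mk K E U) ⊤ (LinearMap.ker f),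
      ∀ m ∈ s, w m (z - ι t) < ε := by
  obtain ⟨t₀, ht₀⟩ := h.exists_seq hu z
  obtain ⟨-, -, hiso, -, hban⟩ := h
  obtain ⟨-, -, hiso', -, -⟩ := h'
  obtain ⟨N, hN⟩ : ∃ N, ∀ m ∈ s, ∀ k, N ≤ k → w m (z - ι (t₀ k)) < ε / 16 := by
    choose N hN using fun m => ht₀ m (ε / 16) (by positivity)
    exact ⟨s.sup N, fun m hm k hk => hN m k ((Finset.le_sup hm).trans hk)⟩
  obtain ⟨t, ht, htN⟩ : ∃ t : ℕ → E ⊗[K] U,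
      (∀ m (ε : ℝ), 0 < ε → ∃ N, ∀ k, N ≤ k → w m (z - ι (t k)) < ε) ∧
      ∀ m ∈ s, ∀ k, w m (z - ι (t k)) < ε / 16 := by
    refine ⟨fun k => t₀ (N + k), fun m ε hε => ?_, fun m hm k => hN m hm _ (by omega)⟩
    obtain ⟨N', hN'⟩ := ht₀ m ε hε
    exact ⟨N', fun k hk => hN' _ (by omega)⟩
  have hdiff : ∀ m k l, projTensorSeminorm K (fun a : E => ‖a‖) (u m) (t k - t l) ≤
      max (w m (z - ι (t k))) (w m (z - ι (t l))) := by
    intro m k l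
    have h1 := (hban.1 m).sub_le_max (ι (t k)) z (ι (t l))
    rw [(hban.1 m).map_sub_rev _ z, ← map_sub, hiso] at h1
    exact h1
  choose G hG htG using fun k => exists_fg_mem_tensorSubspace (t k)
  let F : ℕ → Submodule K E := fun k => (Finset.range (k + 1)).sup G
  have hFmono : Monotone F := fun a b hab =>
    Finset.sup_mono (Finset.range_subset_range.2 (by omega))
  have hF : ∀ k, (F k).FG := fun k => Submodule.fg_finset_sup _ _ fun i _ => hG i
  have htF : ∀ k, t k ∈ tensorSubspace U (F k) := fun k =>
    tensorSubspace_mono (Finset.le_sup (f := G) (Finset.self_mem_range_succ k)) (htG k)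
  obtain ⟨n, _, e, φ, he, heF, hsum, hb⟩ := (hF 0).hasOrthogonalFrame one_lt_two
  have hei : ∀ i, 0 < ‖e i‖ := fun i => norm_pos_iff.2 (he i)
  have hD : ∀ i, 0 < 2 / ‖e i‖ := fun i => div_pos two_pos (hei i)
  choose Φ hΦ0 hΦ hΦb using fun i =>
    exists_functional_extension_seq hFmono hF (φ i) (hD i).le fun a ha => by
      rw [div_mul_eq_mul_div, le_div_iff₀ (hei i)]
      exact hb i a ha
  let X : n → ℕ → U := fun i k => tensorContract U (Φ i k) (t k)
  have hX : ∀ i m k l, k ≤ l → u m (X i l - X i k) ≤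
      8 / ‖e i‖ * max (w m (z - ι (t l))) (w m (z - ι (t k))) := by
    intro i m k l hkl
    have h1 : X i k = tensorContract U (Φ i l) (t k) :=
      tensorContract_congr (fun a ha => (hΦ i k l hkl a ha).symm) (htF k)
    rw [h1, ← map_sub]
    have h2 := seminorm_tensorContract_le (hu.1.1 m) (hF l) (mul_pos two_pos (hD i)) (hΦb i l)
      (Submodule.sub_mem _ (htF l) (tensorSubspace_mono (hFmono hkl) (htF k)))
    refine h2.trans ?_
    have h3 : 2 * (2 * (2 / ‖e i‖)) = 8 / ‖e i‖ := by ring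
    rw [h3]
    have := hei i
    gcongr
    exact hdiff m l k
  have hlim : ∀ i, ∃ x, TendstoFam u (Filter.map (X i) Filter.atTop) x := by
    refine fun i => hu.1.2.2 _ ⟨inferInstance, fun m δ hδ => ?_⟩
    obtain ⟨N, hN⟩ := ht m (δ / (8 / ‖e i‖)) (div_pos hδ (div_pos (by norm_num) (hei i)))
    have hsmall : ∀ k l, N ≤ k → k ≤ l → u m (X i l - X i k) < δ := by
      intro k l hk hkl
      refine (hX i m k l hkl).trans_lt ?_
      rw [← lt_div_iff₀' (div_pos (by norm_num) (hei i))]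
      exact max_lt (hN l (hk.trans hkl)) (hN k hk)
    refine ⟨X i '' Set.Ici N, Filter.image_mem_map (Filter.Ici_mem_atTop N), ?_⟩
    rintro _ ⟨k, hk, rfl⟩ _ ⟨l, hl, rfl⟩
    rcases le_total k l with hkl | hkl
    · rw [(hu.1.1 m).map_sub_rev]
      exact hsmall k l hk hkl
    · exact hsmall l k hl hkl
  choose x hx using hlim
  replace hx : ∀ i m (δ : ℝ), 0 < δ → ∃ N, ∀ k, N ≤ k → u m (X i k - x i) < δ := by
    intro i m δ hδ
    obtain ⟨A, hA, hAx⟩ := hx i m δ hδ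
    obtain ⟨N, hN⟩ := Filter.mem_atTop_sets.1 (Filter.mem_map.1 hA)
    exact ⟨N, fun k hk => hAx _ (hN k hk)⟩
  have hker : ∀ i, f (x i) = 0 := by
    refine fun i => hv.2.1 _ fun m => le_antisymm (le_of_forall_pos_le_add fun δ hδ => ?_)
      ((hv.1 m).1 _)
    obtain ⟨C, hC⟩ := hf m
    obtain ⟨C', hC'⟩ := hg m
    obtain ⟨N, hN⟩ := hx i m (δ / (|C| + 1)) (by positivity)
    have h8 : 0 < 8 / ‖e i‖ := div_pos (by norm_num) (hei i)
    obtain ⟨N', hN'⟩ := ht m (δ / (8 / ‖e i‖ * (|C'| + 1))) (by positivity)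
    let k := max N N'
    have h1 := hN k (le_max_left _ _)
    have h2 := hN' k (le_max_right _ _)
    rw [lt_div_iff₀ (by positivity)] at h1 h2
    have h3 : v m (f (x i) - f (X i k)) ≤ δ := by
      rw [(hv.1 m).map_sub_rev, ← map_sub]
      refine (hC _).trans (le_trans ?_ h1.le)
      nlinarith [le_abs_self C, (hu.1.1 m).1 (X i k - x i)]
    have h4 : v m (f (X i k)) ≤ δ := by
      have h5 : f (X i k) = tensorContract V (Φ i k) (TensorProduct.map LinearMap.id f (t k)) :=
        (tensorContract_map _ _ _).symm
      have h6 := seminorm_tensorContract_le (hv.1 m) (hF k) (mul_pos two_pos (hD i)) (hΦb i k)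
        (map_mem_tensorSubspace f (htF k))
      have h7 : projTensorSeminorm K (fun a : E => ‖a‖) (v m)
          (TensorProduct.map LinearMap.id f (t k)) = w' m (g (ι (t k) - z)) := by
        rw [map_sub, hz, sub_zero, hcomm, hiso']
        rfl
      have h9 : w' m (g (ι (t k) - z)) ≤ (|C'| + 1) * w m (z - ι (t k)) := by
        rw [(hban.1 m).map_sub_rev]
        refine (hC' _).trans ?_
        have := (hban.1 m).1 (ι (t k) - z)
        gcongr
        linarith [le_abs_self C']
      rw [h5]
      refine h6.trans ?_
      rw [h7]
      calc _ ≤ 2 * (2 * (2 / ‖e i‖)) * ((|C'| + 1) * w m (z - ι (t k))) := by gcongr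
        _ = w m (z - ι (t k)) * (8 / ‖e i‖ * (|C'| + 1)) := by ring
        _ ≤ δ := h2.le
    have h10 := (hv.1 m).sub_le_max (f (x i)) (f (X i k)) 0
    simp only [sub_zero] at h10
    rw [zero_add]
    exact h10.trans (max_le h3 h4)
  refine ⟨∑ i, e i ⊗ₜ[K] x i, Submodule.sum_mem _ fun i _ =>
    Submodule.apply_mem_map₂ _ trivial (hker i), fun m hm => ?_⟩
  refine ((hban.1 m).sub_le_max _ (ι (t 0)) _).trans_lt
    (max_lt ((htN m hm 0).trans (by linarith)) ?_)
  have hsub : t 0 - ∑ i, e i ⊗ₜ[K] x i = ∑ i, e i ⊗ₜ[K] (X i 0 - x i) := by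
    simp only [TensorProduct.tmul_sub, Finset.sum_sub_distrib]
    congr 1
    rw [← sum_tmul_tensorContract hsum (htF 0)]
    simp only [X, hΦ0, sum_tmul_tensorContract hsum (htF 0)]
  rw [← map_sub, hiso, hsub]
  refine (projTensorSeminorm_sum_le (r := ε / 2) _ _ (by positivity) fun i => ?_).trans_lt
    (by linarith)
  obtain ⟨k, hk⟩ := hx i m (ε / 2 / ‖e i‖) (div_pos (by positivity) (hei i))
  rw [← le_div_iff₀' (hei i)]
  refine ((hu.1.1 m).sub_le_max _ (X i k) _).trans (max_le ?_ (hk k le_rfl).le)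
  rw [(hu.1.1 m).map_sub_rev]
  have := hei i
  calc _ ≤ 8 / ‖e i‖ * max (w m (z - ι (t k))) (w m (z - ι (t 0))) := hX i m 0 k (Nat.zero_le k)
    _ ≤ 8 / ‖e i‖ * (ε / 16) := by
      gcongr
      exact max_le (htN m hm k).le (htN m hm 0).le
    _ = ε / 2 / ‖e i‖ := by ring

end Completion

section Openness

/-- Openness onto the image, expressed with seminorms: small values of `f` are attained at small
vectors. -/
def IsSeminormOpen {M A B : Type*} [AddCommGroup A] [AddCommGroup B] (u : M → A → ℝ)
    (v : M → B → ℝ) (f : A → B) : Prop :=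
  ∀ (s : Finset M) (ε : ℝ), 0 < ε → ∃ (s' : Finset M) (δ : ℝ), 0 < δ ∧
    ∀ x, (∀ m ∈ s', v m (f x) < δ) → ∃ x', f x' = f x ∧ ∀ m ∈ s, u m x' < ε

theorem exists_almost_contractive_functional {K E : Type*} [NormedField K] [CompleteSpace K]
    [NormedAddCommGroup E] [NormedSpace K E] [IsUltrametricDist E] {b : E} (hb : ‖b‖ = 1)
    {F : Submodule K E} (hF : F.FG) :
    ∃ φ : E →ₗ[K] K, φ b = 1 ∧ ∀ a ∈ F, ‖φ a‖ ≤ 2 * ‖a‖ := by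
  have hb0 : b ∉ (⊥ : Submodule K E) := by
    rw [Submodule.mem_bot, ← norm_eq_zero, hb]
    exact one_ne_zero
  obtain ⟨g, hg, -⟩ := Submodule.exists_le_ker_of_notMem hb0
  obtain ⟨π, hπb, hπ⟩ := (Submodule.fg_span_singleton (R := K) b).exists_almost_contractive_projection
    hF one_lt_two
  refine ⟨((g b)⁻¹ • g) ∘ₗ π, ?_, fun a ha => ?_⟩
  · simp [hπb b (Submodule.mem_span_singleton_self b), hg]
  · obtain ⟨h1, h2⟩ := hπ a (Submodule.mem_sup_right ha)
    obtain ⟨c, hc⟩ := Submodule.mem_span_singleton.1 h1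
    rw [← hc, norm_smul, hb, mul_one] at h2
    have h3 : (((g b)⁻¹ • g) ∘ₗ π) a = c := by simp [← hc, hg, mul_comm]
    rwa [h3]

/-- Openness onto the image descends from the completed tensor product. -/
theorem IsSeminormOpen.descent {K E : Type*} [NormedField K] [CompleteSpace K]
    [NormedAddCommGroup E] [NormedSpace K E] [IsUltrametricDist E] {b : E} (hb : ‖b‖ = 1)
    {M : Type*} {U : Type*} [AddCommGroup U] [Module K U] {V : Type*} [AddCommGroup V] [Module K V]
    {W : Type*} [AddCommGroup W] [Module K W] {W' : Type*} [AddCommGroup W'] [Module K W']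
    {u : M → U → ℝ} (hu : IsFrechetFam K u) {v : M → V → ℝ}
    (hv : IsBanachoid K v) {f : U →ₗ[K] V} (hf : IsBoundedMap u v f) {w : M → W → ℝ}
    {ι : E ⊗[K] U →+ W}
    (h : IsHausdorffCompletion K (projTensorFamily K (fun _ : M => fun a : E => ‖a‖) u) w ι)
    {w' : M → W' → ℝ} {ι' : E ⊗[K] V →+ W'}
    (h' : IsHausdorffCompletion K (projTensorFamily K (fun _ : M => fun a : E => ‖a‖) v) w' ι')
    {g : W →+ W'} (hg : IsBoundedMap w w' g)
    (hcomm : ∀ t, g (ι t) = ι' (TensorProduct.map LinearMap.id f t))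
    (hopen : IsSeminormOpen w w' g) : IsSeminormOpen u v f := by
  intro s ε hε
  obtain ⟨s', δ, hδ, H⟩ := hopen s (ε / 4) (by positivity)
  refine ⟨s', δ, hδ, fun x hx => ?_⟩
  obtain ⟨z', hgz, hz'⟩ := H (ι (b ⊗ₜ x)) fun m hm => by
    rw [hcomm, h'.2.2.1, TensorProduct.map_tmul, LinearMap.id_apply]
    refine (projTensorSeminorm_tmul_le (hv.1 m).1 _ _).trans_lt ?_
    rw [hb, one_mul]
    exact hx m hm
  obtain ⟨t, ht, hts⟩ := exists_tensor_ker_approx hu hv hf h h' hg hcomm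
    (z := ι (b ⊗ₜ x) - z') (by rw [map_sub, hgz, sub_self]) s (by positivity : 0 < ε / 4)
  obtain ⟨F, hF, htF⟩ := exists_fg_mem_tensorSubspace (b ⊗ₜ[K] x - t)
  obtain ⟨φ, hφb, hφ⟩ := exists_almost_contractive_functional hb hF
  have hker : tensorContract U φ t ∈ LinearMap.ker f := by
    have : Submodule.map₂ (TensorProduct.mk K E U) ⊤ (LinearMap.ker f) ≤
        (LinearMap.ker f).comap (tensorContract U φ) :=
      Submodule.map₂_le.2 fun a _ y hy => by
        rw [Submodule.mem_comap, TensorProduct.mk_apply, tensorContract_tmul]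
        exact Submodule.smul_mem _ _ hy
    exact this ht
  have hx' : tensorContract U φ (b ⊗ₜ[K] x - t) = x - tensorContract U φ t := by
    simp [hφb]
  refine ⟨tensorContract U φ (b ⊗ₜ[K] x - t), ?_, fun m hm => ?_⟩
  · rw [hx', map_sub, LinearMap.mem_ker.1 hker, sub_zero]
  · refine (seminorm_tensorContract_le (hu.1.1 m) hF two_pos hφ htF).trans_lt ?_
    have h1 : w m (ι (b ⊗ₜ[K] x - t)) < ε / 4 := by
      have h2 : ι (b ⊗ₜ[K] x - t) = z' + (ι (b ⊗ₜ[K] x) - z' - ι t) := by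
        rw [map_sub]
        abel
      rw [h2]
      exact ((h.2.2.2.2.1 m).2.2 _ _).trans_lt (max_lt (hz' m hm) (hts m hm))
    rw [h.2.2.1] at h1
    change projTensorSeminorm K (fun a : E => ‖a‖) (u m) _ < _ at h1
    linarith

end Openness

section Topology

variable {K A B M : Type*} [NormedField K] [AddCommGroup A] [Module K A]
  [AddCommGroup B] [Module K B]

theorem isOpen_famTopology_ball {u : M → A → ℝ} (x : A) (s : Finset M) {ε : ℝ} (hε : 0 < ε) :
    @IsOpen _ (famTopology u) {y | ∀ m ∈ s, u m (y - x) < ε} := by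
  let := famTopology u
  have : {y | ∀ m ∈ s, u m (y - x) < ε} = ⋂ m ∈ s, {y | u m (y - x) < ε} := by
    ext
    simp
  rw [this]
  exact isOpen_biInter_finset fun m _ =>
    TopologicalSpace.isOpen_generateFrom_of_mem ⟨m, x, ε, hε, rfl⟩

theorem isOpen_famTopology_iff {u : M → A → ℝ} (hu : ∀ m, IsNASeminorm K (u m)) {O : Set A} :
    @IsOpen _ (famTopology u) O ↔ ∀ x ∈ O, ∃ (s : Finset M) (ε : ℝ), 0 < ε ∧
      ∀ y, (∀ m ∈ s, u m (y - x) < ε) → y ∈ O := by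
  classical
  let := famTopology u
  constructor
  · intro hO
    induction (hO : TopologicalSpace.GenerateOpen _ O) with
    | basic O hO =>
      obtain ⟨m, a, ε, hε, rfl⟩ := hO
      exact fun x hx => ⟨{m}, ε, hε, fun y hy =>
        ((hu m).sub_le_max y x a).trans_lt (max_lt (hy m (by simp)) hx)⟩
    | univ => exact fun x _ => ⟨∅, 1, one_pos, fun _ _ => trivial⟩
    | inter O O' h h' ih ih' =>
      rintro x ⟨hx, hx'⟩
      obtain ⟨s, ε, hε, H⟩ := ih x hx
      obtain ⟨s', ε', hε', H'⟩ := ih' x hx'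
      refine ⟨s ∪ s', min ε ε', lt_min hε hε', fun y hy => ⟨H y fun m hm => ?_, H' y fun m hm => ?_⟩⟩
      · exact (hy m (Finset.mem_union_left _ hm)).trans_le (min_le_left _ _)
      · exact (hy m (Finset.mem_union_right _ hm)).trans_le (min_le_right _ _)
    | sUnion S h ih =>
      rintro x ⟨O, hOS, hx⟩
      obtain ⟨s, ε, hε, H⟩ := ih O hOS x hx
      exact ⟨s, ε, hε, fun y hy => ⟨O, hOS, H y hy⟩⟩
  · intro H
    refine isOpen_iff_forall_mem_open.2 fun x hx => ?_
    obtain ⟨s, ε, hε, hs⟩ := H x hx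
    exact ⟨_, hs, isOpen_famTopology_ball x s hε, fun m _ => by
      simpa [(hu m).map_zero] using hε⟩

variable {R : Type*} [Ring R] [Module R A] [Module R B]

theorem IsBoundedMap.continuous_famTopology {u : M → A → ℝ} (hu : ∀ m, IsNASeminorm K (u m))
    {v : M → B → ℝ} (hv : ∀ m, IsNASeminorm K (v m)) {f : A →ₗ[R] B} (hf : IsBoundedMap u v f) :
    @Continuous _ _ (famTopology u) (famTopology v) f := by
  let := famTopology u
  refine continuous_generateFrom_iff.2 ?_
  rintro _ ⟨m, b, ε, hε, rfl⟩
  refine (isOpen_famTopology_iff hu).2 fun x hx => ?_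
  obtain ⟨C, hC⟩ := hf m
  refine ⟨{m}, ε / (|C| + 1), by positivity, fun y hy => ?_⟩
  have h1 := hy m (by simp)
  rw [lt_div_iff₀ (by positivity)] at h1
  refine ((hv m).sub_le_max (f y) (f x) b).trans_lt (max_lt ?_ hx)
  rw [← map_sub]
  refine (hC _).trans_lt (lt_of_le_of_lt ?_ h1)
  nlinarith [le_abs_self C, (hu m).1 (y - x)]

theorem TopologicallyStrict.isSeminormOpen {u : M → A → ℝ} (hu : ∀ m, IsNASeminorm K (u m))
    {v : M → B → ℝ} (hv : ∀ m, IsNASeminorm K (v m)) {f : A →ₗ[R] B}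
    (h : TopologicallyStrict (famTopology u) (famTopology v) f) : IsSeminormOpen u v f := by
  intro s ε hε
  let := famTopology u
  let := famTopology v
  obtain ⟨-, hsymm⟩ := h
  let O : Set (A ⧸ LinearMap.ker f) := (LinearMap.ker f).mkQ '' {x | ∀ m ∈ s, u m x < ε}
  have hO : IsOpen O := by
    have : IsOpen ((LinearMap.ker f).mkQ ⁻¹' O) := by
      refine (isOpen_famTopology_iff hu).2 ?_
      rintro x ⟨x', hx', hxx'⟩
      refine ⟨s, ε, hε, fun y hy => ⟨y - x + x', fun m hm => ?_, ?_⟩⟩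
      · exact ((hu m).2.2 _ _).trans_lt (max_lt (hy m hm) (hx' m hm))
      · rw [map_add, hxx', map_sub, sub_add_cancel]
    exact this
  obtain ⟨T, hT, hTO⟩ := isOpen_induced_iff.1 (hO.preimage hsymm)
  have hmem : ∀ x, f x ∈ T ↔ (LinearMap.ker f).mkQ x ∈ O := by
    intro x
    have h1 := Set.ext_iff.1 hTO ⟨f x, LinearMap.mem_range_self f x⟩
    rw [Set.mem_preimage, Set.mem_preimage, LinearMap.quotKerEquivRange_symm_apply_image] at h1
    exact h1
  obtain ⟨s', δ, hδ, H⟩ := (isOpen_famTopology_iff hv).1 hT (f 0)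
    ((hmem 0).2 ⟨0, fun m _ => by simpa [(hu m).map_zero] using hε, rfl⟩)
  refine ⟨s', δ, hδ, fun x hx => ?_⟩
  obtain ⟨x', hx', hxx'⟩ := (hmem x).1 (H (f x) (by simpa using hx))
  refine ⟨x', ?_, hx'⟩
  rw [Submodule.mkQ_apply, Submodule.mkQ_apply, Submodule.Quotient.eq] at hxx'
  simpa [sub_eq_zero] using hxx'

theorem IsSeminormOpen.topologicallyStrict {u : M → A → ℝ} (hu : ∀ m, IsNASeminorm K (u m))
    {v : M → B → ℝ} (hv : ∀ m, IsNASeminorm K (v m)) {f : A →ₗ[R] B} (hf : IsBoundedMap u v f)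
    (h : IsSeminormOpen u v f) : TopologicallyStrict (famTopology u) (famTopology v) f := by
  let := famTopology u
  let := famTopology v
  refine ⟨continuous_induced_rng.2 (continuous_quot_lift _ (hf.continuous_famTopology hu hv)), ?_⟩
  refine ⟨fun O hO => isOpen_iff_forall_mem_open.2 ?_⟩
  rintro ⟨y, hy⟩ hx
  obtain ⟨x, rfl⟩ := LinearMap.mem_range.1 hy
  rw [Set.mem_preimage, LinearMap.quotKerEquivRange_symm_apply_image] at hx
  have hO' : IsOpen ((LinearMap.ker f).mkQ ⁻¹' O) := hO
  obtain ⟨s, ε, hε, H⟩ := (isOpen_famTopology_iff hu).1 hO' x hx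
  obtain ⟨s', δ, hδ, H'⟩ := h s ε hε
  refine ⟨Subtype.val ⁻¹' {y | ∀ m ∈ s', v m (y - f x) < δ}, ?_,
    (isOpen_famTopology_ball (f x) s' hδ).preimage continuous_subtype_val,
    fun m _ => by simpa [(hv m).map_zero] using hδ⟩
  rintro ⟨z, hz⟩ hy
  obtain ⟨y, rfl⟩ := LinearMap.mem_range.1 hz
  rw [Set.mem_preimage, LinearMap.quotKerEquivRange_symm_apply_image]
  obtain ⟨x', hx', hux'⟩ := H' (y - x) (by simpa using hy)
  have h1 : (LinearMap.ker f).mkQ (x + x') ∈ O := H (x + x') (by simpa using hux')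
  have h2 : (LinearMap.ker f).mkQ y = (LinearMap.ker f).mkQ (x + x') := by
    rw [Submodule.mkQ_apply, Submodule.mkQ_apply, Submodule.Quotient.eq]
    simp [hx']
  rwa [h2]

end Topology

/-- **Descent of topological strictness along a complete scalar extension**
(Proposition `prop:strictnessdescends`).
Let `K` be a complete nonarchimedean valued field and `L` a complete nonarchimedean valued
extension of `K`.  Let `(U, u)` and `(V, v)` be `M`-normoid Fréchet spaces over `K` and let
`f : U → V` be a bounded `K`-linear map.  If the induced map
`f_L = f ⊗̂ 1 : U ⊗̂_K L → V ⊗̂_K L` has finite-dimensional kernel over `L` and is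
topologically strict, then `f` is topologically strict. -/
theorem descent_of_topological_strictness
    {K : Type*} [NormedField K] [IsUltrametricDist K] [CompleteSpace K]
    {L : Type*} [NormedField L] [IsUltrametricDist L] [CompleteSpace L]
    [Algebra K L] (hKL : ∀ c : K, ‖algebraMap K L c‖ = ‖c‖)
    {M : Type*} [Nonempty M]
    {U : Type*} [AddCommGroup U] [Module K U]
    {V : Type*} [AddCommGroup V] [Module K V]
    (u : M → U → ℝ) (hu : IsFrechetFam K u)
    (v : M → V → ℝ) (hv : IsFrechetFam K v)
    (f : U →ₗ[K] V) (hf : IsBoundedMap u v ⇑f)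
    -- realizations `UL`, `VL` of the completed tensor products `U ⊗̂_K L`, `V ⊗̂_K L`
    {UL : Type*} [AddCommGroup UL] [Module K UL] [Module L UL] [IsScalarTower K L UL]
    (uL : M → UL → ℝ) (ιU : L ⊗[K] U →ₗ[L] UL)
    (hUL : IsHausdorffCompletion K
      (projTensorFamily K (fun _ : M => fun a : L => ‖a‖) u) uL ⇑ιU)
    {VL : Type*} [AddCommGroup VL] [Module K VL] [Module L VL] [IsScalarTower K L VL]
    (vL : M → VL → ℝ) (ιV : L ⊗[K] V →ₗ[L] VL)
    (hVL : IsHausdorffCompletion K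
      (projTensorFamily K (fun _ : M => fun a : L => ‖a‖) v) vL ⇑ιV)
    -- the induced map `f_L = f ⊗̂ 1`
    (fL : UL →ₗ[L] VL) (hfLb : IsBoundedMap uL vL ⇑fL)
    (hfLc : ∀ z : L ⊗[K] U, fL (ιU z) = ιV (TensorProduct.map LinearMap.id f z))
    -- `f_L` has finite-dimensional kernel over `L` and is topologically strict
    (hkerL : FiniteDimensional L ↥(LinearMap.ker fL))
    (hstrictL : TopologicallyStrict (famTopology uL) (famTopology vL) fL) :
    TopologicallyStrict (famTopology u) (famTopology v) f := by
  let : NormedSpace K L :=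
    { norm_smul_le := fun c x => by rw [Algebra.smul_def, norm_mul, hKL] }
  have hu' := hu.1.1
  have hv' := hv.1.1
  refine IsSeminormOpen.topologicallyStrict hu' hv' hf ?_
  exact IsSeminormOpen.descent (E := L) (b := (1 : L)) norm_one hu hv.1 hf
    (ι := ιU.toAddMonoidHom) hUL (ι' := ιV.toAddMonoidHom) hVL (g := fL.toAddMonoidHom) hfLb hfLc
    (hstrictL.isSeminormOpen hUL.2.2.2.2.1 hVL.2.2.2.2.1)
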